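/- Let M be a proper Archimedean quadratic module of A. Then the closure of M in the topology induced by the seminorm ‖·‖_M equals {a ∈ A : L(a) ≥ 0 for every linear functional L : A → ℝ with L(M) ⊆ [0, ∞)}. (Equivalently: the closure of M in the finest locally convex topology on A coincides with its ‖·‖_M-closure.) -/

import Mathlib

/-!
Setting: `A` is a commutative unital `ℝ`-algebra.
`X(A)` is formalized as `A →ₐ[ℝ] ℝ`, with the topology induced from the
product topology on `A → ℝ`.
-/

/-- A cone of `A`: closed under addition and under scalar multiplication
by nonnegative reals. -/
def IsCone {A : Type*} [CommRing A] [Algebra ℝ A] (C : Set A) : Prop :=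
  (∀ x ∈ C, ∀ y ∈ C, x + y ∈ C) ∧ ∀ r : ℝ, 0 ≤ r → ∀ x ∈ C, r • x ∈ C

/-- A quadratic module of `A`: a cone containing `0` and `1`, closed under
multiplication by squares. -/
def IsQuadraticModule {A : Type*} [CommRing A] [Algebra ℝ A] (M : Set A) : Prop :=
  IsCone M ∧ (0 : A) ∈ M ∧ (1 : A) ∈ M ∧ ∀ a : A, ∀ m ∈ M, a ^ 2 * m ∈ M

/-- A cone `C` is Archimedean if for every `a ∈ A` there is a real `r ≥ 0`
with `r + a ∈ C` and `r - a ∈ C`. -/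
def IsArchimedeanCone {A : Type*} [CommRing A] [Algebra ℝ A] (C : Set A) : Prop :=
  ∀ a : A, ∃ r : ℝ, 0 ≤ r ∧ algebraMap ℝ A r + a ∈ C ∧ algebraMap ℝ A r - a ∈ C

/-- The seminorm `‖a‖_M = inf {r ∈ ℝ : r + a ∈ M and r - a ∈ M}` associated with
an (Archimedean) quadratic module `M`. -/
noncomputable def mNorm {A : Type*} [CommRing A] [Algebra ℝ A] (M : Set A) (a : A) : ℝ :=
  sInf {r : ℝ | algebraMap ℝ A r + a ∈ M ∧ algebraMap ℝ A r - a ∈ M}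

/-- The topology on `A` induced by a seminorm `ρ`, generated by the open balls. -/
def seminormTopology {A : Type*} [CommRing A] [Algebra ℝ A] (ρ : A → ℝ) :
    TopologicalSpace A :=
  TopologicalSpace.generateFrom
    {U : Set A | ∃ a : A, ∃ ε : ℝ, 0 < ε ∧ U = {x : A | ρ (x - a) < ε}}

/-- The topology on the real character space `X(A) = A →ₐ[ℝ] ℝ`, induced from the
product topology on `ℝ^A`. -/
noncomputable instance XATop {A : Type*} [CommRing A] [Algebra ℝ A] :
    TopologicalSpace (A →ₐ[ℝ] ℝ) :=
  TopologicalSpace.induced (fun α => (α : A → ℝ)) Pi.topologicalSpace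

section

variable {A : Type*} [CommRing A] [Algebra ℝ A] {M : Set A}

theorem IsQuadraticModule.algebraMap_mem (hM : IsQuadraticModule M) {r : ℝ} (hr : 0 ≤ r) :
    algebraMap ℝ A r ∈ M := by
  rw [Algebra.algebraMap_eq_smul_one]
  exact hM.1.2 r hr 1 hM.2.2.1

theorem IsQuadraticModule.nonneg_of_algebraMap_mem (hM : IsQuadraticModule M)
    (hproper : (-1 : A) ∉ M) {r : ℝ} (hr : algebraMap ℝ A r ∈ M) : 0 ≤ r := by
  by_contra! h
  apply hproper
  have key := hM.1.2 (-r⁻¹) (by simpa using h.le) _ hr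
  rwa [Algebra.smul_def, ← map_mul, neg_mul, inv_mul_cancel₀ h.ne, map_neg, map_one] at key

theorem IsQuadraticModule.mNorm_bddBelow (hM : IsQuadraticModule M)
    (hproper : (-1 : A) ∉ M) (a : A) :
    BddBelow {r : ℝ | algebraMap ℝ A r + a ∈ M ∧ algebraMap ℝ A r - a ∈ M} := by
  refine ⟨0, fun r hr => ?_⟩
  have h := hM.1.1 _ hr.1 _ hr.2
  have h' : algebraMap ℝ A (r + r) ∈ M := by
    rw [map_add]
    convert h using 1
    ring
  linarith [hM.nonneg_of_algebraMap_mem hproper h']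

theorem IsQuadraticModule.mNorm_le (hM : IsQuadraticModule M) (hproper : (-1 : A) ∉ M)
    {a : A} {r : ℝ} (h₁ : algebraMap ℝ A r + a ∈ M) (h₂ : algebraMap ℝ A r - a ∈ M) :
    mNorm M a ≤ r :=
  csInf_le (hM.mNorm_bddBelow hproper a) ⟨h₁, h₂⟩

theorem IsArchimedeanCone.exists_lt_of_mNorm_lt (harch : IsArchimedeanCone M)
    {a : A} {ε : ℝ} (h : mNorm M a < ε) :
    ∃ r < ε, algebraMap ℝ A r + a ∈ M ∧ algebraMap ℝ A r - a ∈ M := by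
  obtain ⟨s, -, hs⟩ := harch a
  obtain ⟨r, hr, hrε⟩ := exists_lt_of_csInf_lt ⟨s, hs⟩ h
  exact ⟨r, hrε, hr⟩

theorem IsQuadraticModule.mNorm_add_le (hM : IsQuadraticModule M)
    (harch : IsArchimedeanCone M) (hproper : (-1 : A) ∉ M) (a b : A) :
    mNorm M (a + b) ≤ mNorm M a + mNorm M b := by
  refine le_of_forall_pos_lt_add fun ε hε => ?_
  obtain ⟨r, hr, hr₁, hr₂⟩ :=
    harch.exists_lt_of_mNorm_lt (show mNorm M a < mNorm M a + ε / 2 by linarith)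
  obtain ⟨s, hs, hs₁, hs₂⟩ :=
    harch.exists_lt_of_mNorm_lt (show mNorm M b < mNorm M b + ε / 2 by linarith)
  have h : mNorm M (a + b) ≤ r + s := by
    apply hM.mNorm_le hproper
    · convert hM.1.1 _ hr₁ _ hs₁ using 1
      rw [map_add]
      ring
    · convert hM.1.1 _ hr₂ _ hs₂ using 1
      rw [map_add]
      ring
  linarith

/-- For a subadditive `ρ`, every set open for `seminormTopology ρ` contains a `ρ`-ball around
each of its points. -/
theorem exists_ball_subset_of_isOpen_seminormTopology {ρ : A → ℝ}
    (hρ : ∀ a b, ρ (a + b) ≤ ρ a + ρ b) {U : Set A} (hU : @IsOpen A (seminormTopology ρ) U)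
    {x : A} (hx : x ∈ U) : ∃ ε > 0, ∀ y, ρ (y - x) < ε → y ∈ U := by
  induction hU with
  | basic s hs =>
    obtain ⟨c, ε, -, rfl⟩ := hs
    have hx' : ρ (x - c) < ε := hx
    refine ⟨ε - ρ (x - c), by linarith, fun y hy => ?_⟩
    have h := hρ (y - x) (x - c)
    rw [sub_add_sub_cancel] at h
    change ρ (y - c) < ε
    linarith
  | univ => exact ⟨1, one_pos, fun _ _ => trivial⟩
  | inter s t _ _ ihs iht =>
    obtain ⟨ε, hε, h⟩ := ihs hx.1
    obtain ⟨δ, hδ, h'⟩ := iht hx.2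
    exact ⟨min ε δ, lt_min hε hδ, fun y hy =>
      ⟨h y (hy.trans_le (min_le_left _ _)), h' y (hy.trans_le (min_le_right _ _))⟩⟩
  | sUnion S _ ih =>
    obtain ⟨s, hs, hxs⟩ := hx
    obtain ⟨ε, hε, h⟩ := ih s hs hxs
    exact ⟨ε, hε, fun y hy => ⟨s, hs, h y hy⟩⟩

theorem IsQuadraticModule.mem_mNorm_closure_iff (hM : IsQuadraticModule M)
    (harch : IsArchimedeanCone M) (hproper : (-1 : A) ∉ M) {a : A} :
    a ∈ @closure A (seminormTopology (mNorm M)) M ↔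
      ∀ ε : ℝ, 0 < ε → algebraMap ℝ A ε + a ∈ M := by
  rw [@mem_closure_iff A (seminormTopology (mNorm M))]
  constructor
  · intro h ε hε
    have h₀ : mNorm M (a - a) < ε :=
      (hM.mNorm_le hproper (by simpa using hM.2.1) (by simpa using hM.2.1)).trans_lt hε
    obtain ⟨m, hm, hmM⟩ := h {x | mNorm M (x - a) < ε}
      (TopologicalSpace.GenerateOpen.basic _ ⟨a, ε, hε, rfl⟩) h₀
    obtain ⟨r, hr, -, hr₂⟩ := harch.exists_lt_of_mNorm_lt hm
    convert hM.1.1 _ (hM.1.1 _ hr₂ _ hmM) _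
      (hM.algebraMap_mem (sub_nonneg.2 hr.le)) using 1
    rw [map_sub]
    ring
  · intro h U hU ha
    obtain ⟨ε, hε, hball⟩ :=
      exists_ball_subset_of_isOpen_seminormTopology (hM.mNorm_add_le harch hproper) hU ha
    refine ⟨algebraMap ℝ A (ε / 2) + a, hball _ ?_, h _ (half_pos hε)⟩
    rw [add_sub_cancel_right]
    refine (hM.mNorm_le hproper (r := ε / 2) ?_ ?_).trans_lt (half_lt_self hε)
    · rw [← map_add]
      exact hM.algebraMap_mem (by linarith)
    · simpa using hM.2.1

/-- An element outside a proper Archimedean quadratic module is weakly separated from it by a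
unital functional. -/
theorem IsQuadraticModule.exists_linearMap_nonpos_of_notMem (hM : IsQuadraticModule M)
    (harch : IsArchimedeanCone M) (hproper : (-1 : A) ∉ M) {b : A} (hb : b ∉ M) :
    ∃ L : A →ₗ[ℝ] ℝ, (∀ m ∈ M, 0 ≤ L m) ∧ L 1 = 1 ∧ L b ≤ 0 := by
  have h1 : (1 : A) ≠ 0 := fun h => hproper (by rw [h, neg_zero]; exact hM.2.1)
  let s : PointedCone ℝ A :=
    { carrier := {x | ∃ m ∈ M, ∃ t : ℝ, 0 ≤ t ∧ x = m - t • b}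
      smul_mem' := by
        rintro ⟨c, hc⟩ _ ⟨m, hm, t, ht, rfl⟩
        refine ⟨c • m, hM.1.2 c hc m hm, c * t, mul_nonneg hc ht, ?_⟩
        rw [mul_smul, ← smul_sub]
        rfl
      zero_mem' := ⟨0, hM.2.1, 0, le_rfl, by simp⟩
      add_mem' := by
        rintro _ _ ⟨m, hm, t, ht, rfl⟩ ⟨n, hn, u, hu, rfl⟩
        exact ⟨m + n, hM.1.1 m hm n hn, t + u, add_nonneg ht hu, by
          rw [add_smul]; abel⟩ }
  have hMs : ∀ m ∈ M, m ∈ s := fun m hm => ⟨m, hm, 0, le_rfl, by simp⟩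
  obtain ⟨L, hL, hLs⟩ := riesz_extension s (LinearPMap.mkSpanSingleton (1 : A) (1 : ℝ) h1) (by
    rintro ⟨x, hx⟩ hxs
    obtain ⟨r, rfl⟩ := Submodule.mem_span_singleton.1 hx
    change 0 ≤ LinearPMap.mkSpanSingleton (1 : A) (1 : ℝ) h1 ⟨r • (1 : A), hx⟩
    rw [LinearPMap.mkSpanSingleton'_apply, RingHom.id_apply]
    obtain ⟨m, hm, t, ht, h⟩ := hxs
    change r • (1 : A) = m - t • b at h
    rw [smul_eq_mul, mul_one]
    by_contra! hr
    rcases ht.eq_or_lt with rfl | ht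
    · rw [zero_smul, sub_zero, ← Algebra.algebraMap_eq_smul_one] at h
      exact hr.not_ge (hM.nonneg_of_algebraMap_mem hproper (h ▸ hm))
    · apply hb
      have htb : t • b = m + algebraMap ℝ A (-r) := by
        rw [map_neg, Algebra.algebraMap_eq_smul_one, h]
        abel
      have hmem := hM.1.2 t⁻¹ (inv_nonneg.2 ht.le) _
        (hM.1.1 _ hm _ (hM.algebraMap_mem (neg_nonneg.2 hr.le)))
      rwa [← htb, inv_smul_smul₀ ht.ne'] at hmem) (by
    intro y
    obtain ⟨r, -, hr, -⟩ := harch y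
    refine ⟨⟨algebraMap ℝ A r, ?_⟩, hMs _ hr⟩
    exact Submodule.mem_span_singleton.2 ⟨r, (Algebra.algebraMap_eq_smul_one r).symm⟩)
  refine ⟨L, fun m hm => hLs m (hMs m hm), ?_, ?_⟩
  · rw [hL ⟨1, Submodule.mem_span_singleton_self 1⟩]
    exact LinearPMap.mkSpanSingleton_apply ℝ ℝ h1 1
  · have h := hLs (-b) ⟨0, hM.2.1, 1, zero_le_one, by simp⟩
    rw [map_neg] at h
    linarith

end

/-- For a proper Archimedean quadratic module `M`, the closure of
`M` in the `‖·‖_M`-topology equals the set of all `a ∈ A` on which every linear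
functional nonnegative on `M` is nonnegative (which is the closure of `M` in the
finest locally convex topology on `A`). -/
theorem mNorm_closure_eq_finest_lc_closure {A : Type*} [CommRing A] [Algebra ℝ A]
    (M : Set A) (hM : IsQuadraticModule M) (harch : IsArchimedeanCone M)
    (hproper : (-1 : A) ∉ M) :
    @closure A (seminormTopology (mNorm M)) M
      = {a : A | ∀ L : A →ₗ[ℝ] ℝ, (∀ m ∈ M, 0 ≤ L m) → 0 ≤ L a} := by
  ext a
  rw [hM.mem_mNorm_closure_iff harch hproper, Set.mem_ofPred_eq]
  constructor
  · intro h L hL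
    have h1 : 0 ≤ L 1 := hL 1 hM.2.2.1
    refine le_of_forall_pos_le_add fun ε hε => ?_
    have h' := hL _ (h (ε / (L 1 + 1)) (by positivity))
    rw [map_add, Algebra.algebraMap_eq_smul_one, map_smul, smul_eq_mul] at h'
    have hle : ε / (L 1 + 1) * L 1 ≤ ε := by
      rw [div_mul_eq_mul_div, div_le_iff₀ (by positivity)]
      nlinarith
    linarith
  · intro h ε hε
    by_contra hmem
    obtain ⟨L, hL, hL1, hLb⟩ := hM.exists_linearMap_nonpos_of_notMem harch hproper hmem
    rw [map_add, Algebra.algebraMap_eq_smul_one, map_smul, smul_eq_mul, hL1] at hLb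
    linarith [h L hL]
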